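/- Let n, m be positive integers. The composite Bernstein quadrature functional satisfies I_{n,m}(e₂) - [I_{n,m}(e₁)]² = 1/12 + 1/(6·m²·n), where eⱼ(t) = tʲ; in particular I_{n,m}(e₁) = 1/2. -/

import Mathlib

open Set Finset

noncomputable section

/-- The composite Bernstein quadrature functional `I_{n,m}`. -/
def quadI (n m : ℕ) (f : ℝ → ℝ) : ℝ :=
  (1 / ((m : ℝ) * ((n : ℝ) + 1))) * ∑ k ∈ Finset.Icc 1 m, ∑ i ∈ Finset.range (n + 1),
    f (((k : ℝ) * n - n + i) / ((m : ℝ) * n))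

theorem sum_range_add_cast (n : ℕ) (a : ℝ) :
    ∑ i ∈ Finset.range (n + 1), (a + (i : ℝ)) = ((n : ℝ) + 1) * (a + n / 2) := by
  induction n with
  | zero => simp
  | succ n ih =>
    rw [Finset.sum_range_succ, ih]
    push_cast
    ring

theorem sum_range_add_cast_sq (n : ℕ) (a : ℝ) :
    ∑ i ∈ Finset.range (n + 1), (a + (i : ℝ)) ^ 2 =
      ((n : ℝ) + 1) * (a ^ 2 + a * n + n * (2 * n + 1) / 6) := by
  induction n with
  | zero => simp
  | succ n ih =>
    rw [Finset.sum_range_succ, ih]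
    push_cast
    ring

theorem sum_Icc_sum_range_cast (n m : ℕ) :
    ∑ k ∈ Finset.Icc 1 m, ∑ i ∈ Finset.range (n + 1), ((k : ℝ) * n - n + i) =
      m * ((n : ℝ) + 1) * (m * n / 2) := by
  simp only [sum_range_add_cast]
  induction m with
  | zero => simp
  | succ m ih =>
    rw [Finset.sum_Icc_succ_top (by omega), ih]
    push_cast
    ring

theorem sum_Icc_sum_range_cast_sq (n m : ℕ) :
    ∑ k ∈ Finset.Icc 1 m, ∑ i ∈ Finset.range (n + 1), ((k : ℝ) * n - n + i) ^ 2 =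
      m * ((n : ℝ) + 1) * ((m * n : ℝ) ^ 2 / 3 + n / 6) := by
  simp only [sum_range_add_cast_sq]
  induction m with
  | zero => simp
  | succ m ih =>
    rw [Finset.sum_Icc_succ_top (by omega), ih]
    push_cast
    ring

theorem quadI_id (n m : ℕ) (hn : 0 < n) (hm : 0 < m) :
    quadI n m (fun t => t) = 1 / 2 := by
  have hn' : (n : ℝ) ≠ 0 := by positivity
  have hm' : (m : ℝ) ≠ 0 := by positivity
  have hn1 : (n : ℝ) + 1 ≠ 0 := by positivity
  simp only [quadI, ← Finset.sum_div, sum_Icc_sum_range_cast]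
  field_simp

theorem quadI_sq (n m : ℕ) (hn : 0 < n) (hm : 0 < m) :
    quadI n m (fun t => t ^ 2) = 1 / 3 + 1 / (6 * (m : ℝ) ^ 2 * (n : ℝ)) := by
  have hn' : (n : ℝ) ≠ 0 := by positivity
  have hm' : (m : ℝ) ≠ 0 := by positivity
  have hn1 : (n : ℝ) + 1 ≠ 0 := by positivity
  simp only [quadI, div_pow, ← Finset.sum_div, sum_Icc_sum_range_cast_sq]
  field_simp

theorem quadrature_variance
    (n m : ℕ) (hn : 0 < n) (hm : 0 < m) :
    quadI n m (fun t => t ^ 2) - (quadI n m (fun t => t)) ^ 2 =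
        1 / 12 + 1 / (6 * (m : ℝ) ^ 2 * (n : ℝ)) ∧
      quadI n m (fun t => t) = 1 / 2 := by
  refine ⟨?_, quadI_id n m hn hm⟩
  rw [quadI_id n m hn hm, quadI_sq n m hn hm]
  ring
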